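/- Let k ≥ 2 and n > k³(2k−1), and suppose the (n,k)-Kneser graph has an (n−2k+1)-coloring. Let m = ⌈n/(2k)⌉. Then the (n−m, k)-Kneser graph has an ((n−m) − 2k + 1)-coloring. (One removes m colors among the star-shaped color classes together with m nodes including their central elements, and restricts the coloring.) -/

import Mathlib

/-- The number of `k`-sets containing a given set. -/
lemma card_superset_le {n k : ℕ} (T : Finset (Fin n)) :
    ((Finset.powersetCard k (Finset.univ : Finset (Fin n))).filter (fun S => T ⊆ S)).card
      ≤ (n - T.card).choose (k - T.card) := by
  classical
  have h : (Finset.powersetCard (k - T.card) (Finset.univ \ T)).card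
      = (n - T.card).choose (k - T.card) := by
    rw [Finset.card_powersetCard, Finset.card_sdiff_of_subset (Finset.subset_univ _)]
    simp
  rw [← h]
  apply Finset.card_le_card_of_injOn (fun S => S \ T)
  · intro S hS
    simp only [Finset.coe_filter, Finset.mem_powersetCard, Set.mem_ofPred_eq] at hS
    simp only [Finset.mem_coe, Finset.mem_powersetCard]
    exact ⟨Finset.sdiff_subset_sdiff (Finset.subset_univ _) le_rfl, by
      rw [Finset.card_sdiff_of_subset hS.2, hS.1.2]⟩
  · intro S hS R hR he
    simp only [Finset.coe_filter, Set.mem_ofPred_eq] at hS hR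
    simp only at he
    rw [← Finset.sdiff_union_of_subset hS.2, he, Finset.sdiff_union_of_subset hR.2]

/-- A non-star intersecting family of `k`-sets is small. -/
lemma nonstar_card_le {n k : ℕ} (hn : 0 < n) (P : Finset (Finset (Fin n)))
    (hP : ∀ S ∈ P, S.card = k) (hint : ∀ S ∈ P, ∀ T ∈ P, ¬ Disjoint S T)
    (hns : ¬ ∃ x, ∀ S ∈ P, x ∈ S) :
    P.card ≤ k ^ 2 * (n - 2).choose (k - 2) := by
  classical
  push Not at hns
  choose B hB hxB using hns
  let A := B ⟨0, hn⟩
  have hsub : P ⊆ A.biUnion (fun a => (B a).biUnion (fun b =>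
      if a = b then ∅ else
      (Finset.powersetCard k (Finset.univ : Finset (Fin n))).filter
        (fun S => ({a, b} : Finset (Fin n)) ⊆ S))) := by
    intro S hS
    obtain ⟨a, haS, haA⟩ := Finset.not_disjoint_iff.1 (hint S hS A (hB _))
    obtain ⟨b, hbS, hbB⟩ := Finset.not_disjoint_iff.1 (hint S hS (B a) (hB _))
    have hab : a ≠ b := fun e => hxB a (e ▸ hbB)
    simp only [Finset.mem_biUnion]
    refine ⟨a, haA, b, hbB, ?_⟩
    rw [if_neg hab]
    simp [Finset.mem_powersetCard, hP S hS, Finset.insert_subset_iff, haS, hbS]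
  refine (Finset.card_le_card hsub).trans ?_
  have h1 : ∀ a ∈ A, ((B a).biUnion (fun b =>
      if a = b then ∅ else
      (Finset.powersetCard k (Finset.univ : Finset (Fin n))).filter
        (fun S => ({a, b} : Finset (Fin n)) ⊆ S))).card ≤ k * (n - 2).choose (k - 2) := by
    intro a _
    have := Finset.card_biUnion_le_card_mul (B a) (fun b =>
      if a = b then ∅ else
      (Finset.powersetCard k (Finset.univ : Finset (Fin n))).filter
        (fun S => ({a, b} : Finset (Fin n)) ⊆ S)) ((n - 2).choose (k - 2)) (by
        intro b _
        split_ifs with hab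
        · simp
        · have := card_superset_le (k := k) ({a, b} : Finset (Fin n))
          rwa [Finset.card_pair hab] at this)
    rwa [hP _ (hB a)] at this
  have := Finset.card_biUnion_le_card_mul A _ _ h1
  rw [hP A (hB _)] at this
  calc _ ≤ _ := this
    _ = _ := by ring

lemma arith_contra {n k s N : ℕ} (hk : 2 ≤ k) (hn : k ^ 3 * (2 * k - 1) < n)
    (hkn : k ≤ n) (hs : 2 * k * s < n) (hN : N ≤ n - 1)
    (h : n.choose k ≤ s * (n - 1).choose (k - 1) + N * (k ^ 2 * (n - 2).choose (k - 2))) :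
    False := by
  obtain ⟨j, rfl⟩ : ∃ j, k = j + 2 := ⟨k - 2, by omega⟩
  obtain ⟨p, rfl⟩ : ∃ p, n = p + 2 := ⟨n - 2, by omega⟩
  have e1 : (p + 1 + 1) * (p + 1).choose (j + 1)
      = (p + 1 + 1).choose (j + 1 + 1) * (j + 1 + 1) := Nat.add_one_mul_choose_eq _ _
  have e2 : (p + 1) * p.choose j = (p + 1).choose (j + 1) * (j + 1) :=
    Nat.add_one_mul_choose_eq _ _
  have hD : 0 < p.choose j := Nat.choose_pos (by omega)
  have hBpos : 0 < (p + 1).choose (j + 1) := Nat.choose_pos (by omega)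
  simp only [show p + 2 - 1 = p + 1 by omega, show p + 2 - 2 = p by omega,
    show j + 2 - 1 = j + 1 by omega, show j + 2 - 2 = j by omega,
    show 2 * (j + 2) - 1 = 2 * j + 3 by omega] at *
  set A := (p + 2).choose (j + 2) with hA
  change (p + 2) * (p + 1).choose (j + 1) = A * (j + 2) at e1
  generalize (p + 1).choose (j + 1) = B at *
  generalize p.choose j = D at *
  have h2 : N * ((j + 2) ^ 2 * D) ≤ (p + 1) * ((j + 2) ^ 2 * D) := Nat.mul_le_mul_right _ hN
  have h3 : A ≤ s * B + (j + 2) ^ 2 * (B * (j + 1)) := by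
    rw [← e2]
    calc A ≤ _ := h
      _ ≤ s * B + (p + 1) * ((j + 2) ^ 2 * D) := by omega
      _ = _ := by ring
  have h4 : 2 * ((p + 2) * B) ≤ (2 * (j + 2) * s + 2 * (j + 2) ^ 3 * (j + 1)) * B := by
    rw [e1]
    calc 2 * (A * (j + 2)) ≤ 2 * ((s * B + (j + 2) ^ 2 * (B * (j + 1))) * (j + 2)) := by gcongr
      _ = _ := by ring
  have h5 : 2 * (p + 2) ≤ 2 * (j + 2) * s + 2 * (j + 2) ^ 3 * (j + 1) := by
    apply Nat.le_of_mul_le_mul_right _ hBpos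
    calc _ = 2 * ((p + 2) * B) := by ring
      _ ≤ _ := h4
  have h6 : (j + 2) ^ 3 * (2 * j + 3) = 2 * (j + 2) ^ 3 * (j + 1) + (j + 2) ^ 3 := by ring
  omega

/-- For `k ≥ 2` and `n > k³(2k-1)`, with `m = ⌈n/(2k)⌉`: if the `(n,k)`-Kneser graph
has an `(n-2k+1)`-coloring, then the `(n-m,k)`-Kneser graph has an
`((n-m) - 2k + 1)`-coloring. -/
theorem descent_step (n k m : ℕ) (hk : 2 ≤ k) (hn : k ^ 3 * (2 * k - 1) < n)
    (hm : m = (n + 2 * k - 1) / (2 * k))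
    (h : ∃ c : Finset (Fin n) → ℕ,
      (∀ S : Finset (Fin n), S.card = k → c S ∈ Finset.Icc 1 (n - 2 * k + 1)) ∧
      (∀ S T : Finset (Fin n), S.card = k → T.card = k →
        Disjoint S T → c S ≠ c T)) :
    ∃ c' : Finset (Fin (n - m)) → ℕ,
      (∀ S : Finset (Fin (n - m)), S.card = k → c' S ∈ Finset.Icc 1 (n - m - 2 * k + 1)) ∧
      (∀ S T : Finset (Fin (n - m)), S.card = k → T.card = k →
        Disjoint S T → c' S ≠ c' T) := by
  classical
  obtain ⟨c, hc, hd⟩ := h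
  have hk3 : 8 * k ≤ k ^ 3 * (2 * k - 1) := by
    have h1 : 2 * 2 * k ≤ k ^ 3 := by
      calc 2 * 2 * k ≤ k * k * k := by gcongr
        _ = k ^ 3 := by ring
    calc 8 * k = (2 * 2 * k) * 2 := by ring
      _ ≤ k ^ 3 * (2 * k - 1) := Nat.mul_le_mul h1 (by omega)
  have hmlt : ∀ s, s < m → 2 * k * s < n := by
    intro s hs
    have h1 : (s + 1) ≤ (n + 2 * k - 1) / (2 * k) := by omega
    rw [Nat.le_div_iff_mul_le (by omega)] at h1
    have : (s + 1) * (2 * k) = 2 * k * s + 2 * k := by ring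
    omega
  have hmn : m + 2 * k ≤ n := by
    by_contra hcon
    have h1 := hmlt (n - 2 * k) (by omega)
    have h2 : 4 * (n - 2 * k) ≤ 2 * k * (n - 2 * k) := Nat.mul_le_mul_right _ (by omega)
    omega
  set N := n - 2 * k + 1 with hN
  let V := Finset.powersetCard k (Finset.univ : Finset (Fin n))
  have hV : ∀ S, S ∈ V ↔ S.card = k := by intro S; simp [V, Finset.mem_powersetCard]
  let P : ℕ → Finset (Finset (Fin n)) := fun l => V.filter (fun S => c S = l)
  let star : ℕ → Prop := fun l => ∃ x, ∀ S ∈ P l, x ∈ S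
  let St := (Finset.Icc 1 N).filter star
  have hSt : m ≤ St.card := by
    by_contra hlt
    push Not at hlt
    refine arith_contra (s := St.card) (N := N) hk hn (by omega) (hmlt _ hlt) (by omega) ?_
    have hcard : n.choose k = V.card := by simp [V]
    have hsum : V.card = ∑ l ∈ Finset.Icc 1 N, (P l).card :=
      Finset.card_eq_sum_card_fiberwise (fun S hS => hc S ((hV S).1 hS))
    rw [hcard, hsum, ← Finset.sum_filter_add_sum_filter_not _ star]
    apply add_le_add
    · apply Finset.sum_le_card_nsmul
      intro l hl
      obtain ⟨x, hx⟩ := (Finset.mem_filter.1 hl).2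
      have := card_superset_le (k := k) ({x} : Finset (Fin n))
      rw [Finset.card_singleton] at this
      refine le_trans (Finset.card_le_card ?_) this
      intro S hS
      exact Finset.mem_filter.2 ⟨(Finset.mem_filter.1 hS).1, by simpa using hx S hS⟩
    · refine le_trans (Finset.sum_le_card_nsmul _ _ (k ^ 2 * (n - 2).choose (k - 2)) ?_) ?_
      · intro l hl
        apply nonstar_card_le (by omega) (P l)
        · intro S hS
          exact (hV S).1 (Finset.mem_filter.1 hS).1
        · intro S hS T hT hdis
          obtain ⟨h1, h2⟩ := Finset.mem_filter.1 hS
          obtain ⟨h3, h4⟩ := Finset.mem_filter.1 hT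
          exact hd S T ((hV S).1 h1) ((hV T).1 h3) hdis (h2.trans h4.symm)
        · exact (Finset.mem_filter.1 hl).2
      · rw [smul_eq_mul]
        apply Nat.mul_le_mul_right
        exact (Finset.card_filter_le _ _).trans (by simp)
  obtain ⟨M, hMS, hMc⟩ := Finset.exists_subset_card_eq hSt
  have hstar : ∀ l, ∃ x : Fin n, l ∈ M → ∀ S ∈ P l, x ∈ S := by
    intro l
    by_cases hl : l ∈ M
    · obtain ⟨x, hx⟩ := (Finset.mem_filter.1 (hMS hl)).2
      exact ⟨x, fun _ => hx⟩
    · exact ⟨⟨0, by omega⟩, fun h => absurd h hl⟩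
  choose f hf using hstar
  obtain ⟨X, hX, hXc⟩ := Finset.exists_superset_card_eq (s := M.image f) (n := m)
    (Finset.card_image_le.trans hMc.le) (by simp; omega)
  have hYc : (Finset.univ \ X).card = n - m := by
    rw [Finset.card_sdiff_of_subset (Finset.subset_univ _), hXc]; simp
  let e : Fin (n - m) ↪ Fin n := ((Finset.univ \ X).orderEmbOfFin hYc).toEmbedding
  have he : ∀ i, e i ∉ X := by
    intro i
    have : e i ∈ Finset.univ \ X := Finset.orderEmbOfFin_mem _ hYc i
    simpa using this
  have hKc : ((Finset.Icc 1 N) \ M).card = n - m - 2 * k + 1 := by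
    rw [Finset.card_sdiff_of_subset (hMS.trans (Finset.filter_subset _ _)), hMc]
    simp; omega
  have hmem : ∀ S : Finset (Fin (n - m)), S.card = k →
      c (S.map e) ∈ (Finset.Icc 1 N) \ M := by
    intro S hS
    have h1 : (S.map e).card = k := by rw [Finset.card_map, hS]
    refine Finset.mem_sdiff.2 ⟨hc _ h1, fun hM => ?_⟩
    have h2 := hf _ hM (S.map e) (Finset.mem_filter.2 ⟨(hV _).2 h1, rfl⟩)
    obtain ⟨i, _, hi⟩ := Finset.mem_map.1 h2
    exact he i (hi ▸ hX (Finset.mem_image_of_mem f hM))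
  let g := Finset.equivFinOfCardEq hKc
  refine ⟨fun S => if hS : S.card = k then (g ⟨_, hmem S hS⟩ : ℕ) + 1 else 0, ?_, ?_⟩
  · intro S hS
    beta_reduce
    rw [dif_pos hS, Finset.mem_Icc]
    have := (g ⟨_, hmem S hS⟩).2
    omega
  · intro S T hS hT hST heq
    beta_reduce at heq
    rw [dif_pos hS, dif_pos hT] at heq
    have h1 := g.injective (Fin.ext (Nat.add_right_cancel heq))
    exact hd (S.map e) (T.map e) (by simpa using hS) (by simpa using hT)
      ((Finset.disjoint_map e).2 hST) (congrArg Subtype.val h1)
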